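/- arXiv:2205.05329 — 2 statements merged into one kernel-verified Lean document; each statement's English description precedes it below -/
import Mathlib

section
/- Let k be a field with char(k)=0 or char(k)>d, and Q ∈ k[V] a homogeneous form of degree d with associated multilinear form Q̃. If Q = Σ_{i=1}^r R_i S_i with R_i, S_i forms of positive degree, then prk_k(Q̃) ≤ binom(d, ⌊d/2⌋) · r. In particular prk_k(Q̃) ≤ binom(d, ⌊d/2⌋) · rk_k(Q). -/
open scoped BigOperators

/-- A multilinear form has partition rank one if it factors as a product of two
multilinear forms on complementary nonempty subsets of the coordinates. -/
def IsPartRankOne {k : Type*} [Field k] {d : ℕ} {V : Fin d → Type*}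
    [∀ i, AddCommGroup (V i)] [∀ i, Module k (V i)]
    (P : MultilinearMap k V k) : Prop :=
  ∃ I : Set (Fin d), I.Nonempty ∧ Iᶜ.Nonempty ∧
    ∃ (R : MultilinearMap k (fun i : I => V i.1) k)
      (S : MultilinearMap k (fun j : ↥Iᶜ => V j.1) k),
      ∀ x : (∀ i, V i), P x = R (fun i => x i.1) * S (fun j => x j.1)

/-- `P` is a sum of `r` partition-rank-one multilinear forms. -/
def HasPrkDecomp {k : Type*} [Field k] {d : ℕ} {V : Fin d → Type*}
    [∀ i, AddCommGroup (V i)] [∀ i, Module k (V i)]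
    (P : MultilinearMap k V k) (r : ℕ) : Prop :=
  ∃ Q : Fin r → MultilinearMap k V k, (∀ i, IsPartRankOne (Q i)) ∧ P = ∑ i, Q i

theorem weight_sum {k : Type*} [Field k] {d : ℕ} (f : Fin d → Fin d) :
    ∑ T : Finset (Fin d), (-1 : k) ^ (Tᶜ).card * ∏ j, (if f j ∈ T then (1 : k) else 0)
      = if Function.Surjective f then 1 else 0 := by
  classical
  have h := Fintype.prod_add (fun _ : Fin d => (1 : k))
    (fun a => if a ∈ Set.range f then (0 : k) else -1)
  have h1 : ∏ a : Fin d, ((1 : k) + (if a ∈ Set.range f then (0 : k) else -1))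
      = if Function.Surjective f then 1 else 0 := by
    split_ifs with hs
    · apply Finset.prod_eq_one
      intro a _
      rw [if_pos (show a ∈ Set.range f from hs a)]; simp
    · simp only [Function.Surjective, not_forall] at hs
      obtain ⟨a, ha⟩ := hs
      apply Finset.prod_eq_zero (Finset.mem_univ a)
      rw [if_neg (by simpa using ha)]; simp
  rw [← h1, h]
  apply Finset.sum_congr rfl
  intro T _
  rw [Finset.prod_const_one, one_mul]
  by_cases hT : ∀ j, f j ∈ T
  · rw [Finset.prod_eq_one (fun j _ => if_pos (hT j)), mul_one, ← Finset.prod_const]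
    apply Finset.prod_congr rfl
    intro a ha
    rw [if_neg]
    rintro ⟨j, rfl⟩
    exact (Finset.mem_compl.1 ha) (hT j)
  · push Not at hT
    obtain ⟨j, hj⟩ := hT
    rw [Finset.prod_eq_zero (Finset.mem_univ j) (if_neg hj), mul_zero]
    symm
    apply Finset.prod_eq_zero (Finset.mem_compl.2 hj)
    rw [if_pos ⟨j, rfl⟩]

theorem polar_zero {k : Type*} [Field k] {d : ℕ} {W : Type*} [AddCommGroup W] [Module k W]
    (M : MultilinearMap k (fun _ : Fin d => W) k) (h : ∀ x, M (fun _ => x) = 0)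
    (x : Fin d → W) : ∑ σ : Equiv.Perm (Fin d), M (fun i => x (σ i)) = 0 := by
  classical
  have hT : ∀ T : Finset (Fin d),
      ∑ f : Fin d → Fin d, (∏ j, (if f j ∈ T then (1 : k) else 0)) * M (fun j => x (f j)) = 0 := by
    intro T
    have := h (∑ i, (if i ∈ T then (1 : k) else 0) • x i)
    rw [MultilinearMap.map_sum] at this
    refine Eq.trans ?_ this
    apply Finset.sum_congr rfl
    intro f _
    rw [MultilinearMap.map_smul_univ, smul_eq_mul]
  have h2 : ∑ f : Fin d → Fin d, (if Function.Surjective f then (1 : k) else 0)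
      * M (fun j => x (f j)) = 0 := by
    simp_rw [← weight_sum, Finset.sum_mul]
    rw [Finset.sum_comm]
    apply Finset.sum_eq_zero
    intro T _
    simp_rw [mul_assoc]
    rw [← Finset.mul_sum, hT, mul_zero]
  rw [← h2]
  apply Fintype.sum_of_injective (fun σ : Equiv.Perm (Fin d) => (σ : Fin d → Fin d))
    (DFunLike.coe_injective)
  · intro f hf
    rw [if_neg, zero_mul]
    intro hs
    exact hf ⟨Equiv.ofBijective f (Finite.injective_iff_surjective.2 hs |> fun hi => ⟨hi, hs⟩), rfl⟩
  · intro σ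
    rw [if_pos σ.surjective, one_mul]

theorem exists_multilinear {k : Type*} [Field k] {s e : ℕ} (R : MvPolynomial (Fin s) k)
    (hR : R.IsHomogeneous e) :
    ∃ A : MultilinearMap k (fun _ : Fin e => Fin s → k) k,
      ∀ x, A (fun _ => x) = MvPolynomial.eval x R := by
  classical
  have key : ∀ m : Fin s →₀ ℕ, ∃ A : MultilinearMap k (fun _ : Fin e => Fin s → k) k,
      m ∈ R.support → ∀ x, A (fun _ => x) = ∏ i, x i ^ m i := by
    intro m
    by_cases hm : m ∈ R.support
    swap
    · exact ⟨0, fun h => absurd h hm⟩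
    have hdeg : m.degree = e := by
      have := hR (MvPolynomial.mem_support_iff.1 hm)
      rw [Finsupp.degree_eq_weight_one]
      exact this
    have hlen : (Finsupp.toMultiset m).toList.length = e := by
      rw [Multiset.length_toList, Finsupp.card_toMultiset, ← hdeg]
      rfl
    let l : Fin e → Fin s := fun j => (Finsupp.toMultiset m).toList.get (j.cast hlen.symm)
    refine ⟨(MultilinearMap.mkPiAlgebra k (Fin e) k).compLinearMap
      (fun j => LinearMap.proj (l j)), fun _ x => ?_⟩
    have h1 : ((Finsupp.toMultiset m).map x).prod = ∏ i, x i ^ m i := by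
      rw [Finsupp.toMultiset_map, Finsupp.prod_toMultiset, Finsupp.prod_mapDomain_index (by simp) (by intros; rw [pow_add])]
      exact Finsupp.prod_fintype _ _ (by simp)
    rw [← h1]
    conv_rhs => rw [← Multiset.coe_toList (Finsupp.toMultiset m)]
    rw [Multiset.map_coe, Multiset.prod_coe]
    simp only [MultilinearMap.compLinearMap_apply, MultilinearMap.mkPiAlgebra_apply,
      LinearMap.proj_apply, l]
    rw [← List.ofFn_get ((Finsupp.toMultiset m).toList.map x), List.prod_ofFn]
    apply Fintype.prod_equiv (finCongr (by simpa using hlen.symm))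
    intro j
    simp
  choose A hA using key
  refine ⟨∑ m ∈ R.support, R.coeff m • A m, fun x => ?_⟩
  rw [MvPolynomial.eval_eq', _root_.sum_apply]
  apply Finset.sum_congr rfl
  intro m hm
  rw [_root_.smul_apply, hA m hm, smul_eq_mul]

/-- sum over all bijections, grouped by the image of the left part -/
theorem sum_equiv_split {k : Type*} [Field k] {d e f : ℕ}
    (F : (Fin e → Fin d) → k) (G : (Fin f → Fin d) → k) :
    ∑ q : (Fin e ⊕ Fin f) ≃ Fin d, F (fun i => q (Sum.inl i)) * G (fun j => q (Sum.inr j))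
    = ∑ I ∈ (Finset.univ : Finset (Fin d)).powersetCard e,
      (∑ a : Fin e ≃ ↥(↑I : Set (Fin d)), F (fun i => (a i).1)) *
      (∑ b : Fin f ≃ ↥((↑I : Set (Fin d))ᶜ), G (fun i => (b i).1)) := by
  classical
  rw [← Finset.sum_fiberwise_of_maps_to
    (g := fun q : (Fin e ⊕ Fin f) ≃ Fin d => Finset.univ.image (fun i => q (Sum.inl i)))
    (t := (Finset.univ : Finset (Fin d)).powersetCard e)]
  swap
  · intro q _
    rw [Finset.mem_powersetCard]
    refine ⟨Finset.subset_univ _, ?_⟩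
    exact (Finset.card_image_of_injective _ (q.injective.comp Sum.inl_injective)).trans (by simp)
  apply Finset.sum_congr rfl
  intro I _
  rw [Finset.sum_mul_sum, ← Finset.sum_product']
  symm
  apply Finset.sum_bij (fun (p : (Fin e ≃ ↥(↑I : Set (Fin d))) × (Fin f ≃ ↥((↑I : Set (Fin d))ᶜ))) _ =>
    (Equiv.sumCongr p.1 p.2).trans (Equiv.Set.sumCompl (↑I : Set (Fin d))))
  · rintro ⟨a, b⟩ _
    simp only [Finset.mem_filter, Finset.mem_univ, true_and]
    ext z
    simp only [Finset.mem_image, Finset.mem_univ, true_and, Equiv.trans_apply,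
      Equiv.sumCongr_apply, Sum.map_inl, Equiv.Set.sumCompl_apply_inl]
    constructor
    · rintro ⟨i, rfl⟩
      exact (a i).2
    · intro hz
      exact ⟨a.symm ⟨z, hz⟩, by simp⟩
  · rintro ⟨a, b⟩ _ ⟨a', b'⟩ _ h
    ext i
    · have := congrArg (fun q => (q (Sum.inl i)).1) h
      exact this
    · have := congrArg (fun q => (q (Sum.inr i)).1) h
      exact this
  · intro q hq
    simp only [Finset.mem_filter, Finset.mem_univ, true_and] at hq
    have hl : ∀ i, q (Sum.inl i) ∈ (↑I : Set (Fin d)) := by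
      intro i; rw [← hq]; simp
    have hr : ∀ j, q (Sum.inr j) ∈ (↑I : Set (Fin d))ᶜ := by
      intro i; rw [← hq]; simp
    refine ⟨(Equiv.ofBijective (fun i => ⟨q (Sum.inl i), hl i⟩) ⟨?_, ?_⟩,
      Equiv.ofBijective (fun i => ⟨q (Sum.inr i), hr i⟩) ⟨?_, ?_⟩), Finset.mem_univ _, ?_⟩
    · intro i j h
      simpa using h
    · rintro ⟨z, hz⟩
      rw [← hq] at hz
      simp at hz
      obtain ⟨i, hi⟩ := hz
      exact ⟨i, Subtype.ext hi⟩
    · intro i j h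
      simpa using h
    · rintro ⟨z, hz⟩
      obtain ⟨w, rfl⟩ := q.surjective z
      rcases w with i | j
      · exact absurd (hl i) hz
      · exact ⟨j, rfl⟩
    · ext w
      rcases w with i | j <;> rfl
  · rintro ⟨a, b⟩ _
    rfl

section decomp

variable {k : Type*} [Field k] {d : ℕ} {V : Fin d → Type*}
    [∀ i, AddCommGroup (V i)] [∀ i, Module k (V i)]

theorem HasPrkDecomp.zero : HasPrkDecomp (0 : MultilinearMap k V k) 0 :=
  ⟨fun i => i.elim0, fun i => i.elim0, by simp⟩

theorem HasPrkDecomp.add {P P' : MultilinearMap k V k} {m n : ℕ} (h : HasPrkDecomp P m)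
    (h' : HasPrkDecomp P' n) : HasPrkDecomp (P + P') (m + n) := by
  obtain ⟨Q, hQ, rfl⟩ := h
  obtain ⟨Q', hQ', rfl⟩ := h'
  refine ⟨Fin.append Q Q', ?_, ?_⟩
  · intro i
    refine Fin.addCases (fun i => ?_) (fun i => ?_) i
    · rw [Fin.append_left]; exact hQ i
    · rw [Fin.append_right]; exact hQ' i
  · rw [Fin.sum_univ_add]; simp

theorem IsPartRankOne.zero (hd : 1 < d) : IsPartRankOne (0 : MultilinearMap k V k) := by
  have h0 : 0 < d := by omega
  refine ⟨{⟨0, h0⟩}, ⟨_, rfl⟩, ⟨⟨1, hd⟩, by simp⟩, 0, 0, by simp⟩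

theorem HasPrkDecomp.mono (hd : 1 < d) {P : MultilinearMap k V k} {m n : ℕ}
    (h : HasPrkDecomp P m) (hmn : m ≤ n) : HasPrkDecomp P n := by
  obtain ⟨c, rfl⟩ := Nat.exists_eq_add_of_le hmn
  have h0 : HasPrkDecomp (0 : MultilinearMap k V k) c :=
    ⟨fun _ => 0, fun _ => IsPartRankOne.zero hd, by simp⟩
  simpa using h.add h0

theorem HasPrkDecomp.sum {ι : Type*} (t : Finset ι) (P : ι → MultilinearMap k V k) (m : ℕ)
    (h : ∀ i ∈ t, HasPrkDecomp (P i) m) : HasPrkDecomp (∑ i ∈ t, P i) (t.card * m) := by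
  classical
  induction t using Finset.induction_on with
  | empty => simpa using HasPrkDecomp.zero
  | insert a t ha ih =>
    rw [Finset.sum_insert ha, Finset.card_insert_of_notMem ha, add_mul, one_mul, add_comm _ m]
    exact (h a (by simp)).add (ih (fun i hi => h i (by simp [hi])))

theorem HasPrkDecomp.of_one {P : MultilinearMap k V k} (h : IsPartRankOne P) :
    HasPrkDecomp P 1 := ⟨fun _ => P, fun _ => h, by simp⟩

end decomp

/-- the product of two multilinear forms in disjoint sets of variables -/
noncomputable def mulForm {k : Type*} [Field k] {W : Type*} [AddCommGroup W] [Module k W]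
    {ι₁ ι₂ ι : Type*} (A : MultilinearMap k (fun _ : ι₁ => W) k)
    (B : MultilinearMap k (fun _ : ι₂ => W) k) (ε : ι₁ ⊕ ι₂ ≃ ι) :
    MultilinearMap k (fun _ : ι => W) k :=
  ((LinearMap.mul' k k).compMultilinearMap (A.domCoprod B)).domDomCongr ε

theorem mulForm_apply {k : Type*} [Field k] {W : Type*} [AddCommGroup W] [Module k W]
    {ι₁ ι₂ ι : Type*} (A : MultilinearMap k (fun _ : ι₁ => W) k)
    (B : MultilinearMap k (fun _ : ι₂ => W) k) (ε : ι₁ ⊕ ι₂ ≃ ι) (x : ι → W) :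
    mulForm A B ε x = A (fun i => x (ε (Sum.inl i))) * B (fun i => x (ε (Sum.inr i))) := by
  simp [mulForm]

/-- The symmetrization of a product of forms is a sum of `d.choose e` partition rank one terms. -/
theorem symm_decomp {k : Type*} [Field k] {W : Type*} [AddCommGroup W] [Module k W]
    {d e f : ℕ} (he : 0 < e) (hed : e < d) (A : MultilinearMap k (fun _ : Fin e => W) k)
    (B : MultilinearMap k (fun _ : Fin f => W) k) (ε : Fin e ⊕ Fin f ≃ Fin d) :
    HasPrkDecomp (∑ σ : Equiv.Perm (Fin d), (mulForm A B ε).domDomCongr σ) (d.choose e) := by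
  classical
  let P : Finset (Fin d) → MultilinearMap k (fun _ : Fin d => W) k := fun I =>
    mulForm (∑ a : Fin e ≃ ↥(↑I : Set (Fin d)), A.domDomCongr a)
      (∑ b : Fin f ≃ ↥((↑I : Set (Fin d))ᶜ), B.domDomCongr b) (Equiv.Set.sumCompl _)
  have hP : ∑ σ : Equiv.Perm (Fin d), (mulForm A B ε).domDomCongr σ
      = ∑ I ∈ (Finset.univ : Finset (Fin d)).powersetCard e, P I := by
    apply MultilinearMap.ext
    intro x
    simp only [_root_.sum_apply, P, mulForm_apply, MultilinearMap.domDomCongr_apply,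
      Equiv.Set.sumCompl_apply_inl, Equiv.Set.sumCompl_apply_inr]
    rw [← sum_equiv_split (fun u => A (fun i => x (u i))) (fun u => B (fun i => x (u i)))]
    apply Fintype.sum_equiv (Equiv.equivCongr ε.symm (Equiv.refl (Fin d)))
    intro σ
    simp
  rw [hP]
  have := HasPrkDecomp.sum ((Finset.univ : Finset (Fin d)).powersetCard e) P 1 ?_
  · simpa using this
  · intro I hI
    have hc : I.card = e := (Finset.mem_powersetCard.1 hI).2
    apply HasPrkDecomp.of_one
    refine ⟨(↑I : Set (Fin d)), ?_, ?_, _, _, fun x => mulForm_apply _ _ _ x⟩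
    · rw [Finset.coe_nonempty, ← Finset.card_pos]; omega
    · rw [← Finset.coe_compl, Finset.coe_nonempty, ← Finset.card_pos, Finset.card_compl,
        Fintype.card_fin]
      omega

theorem partition_rank_le_binom_mul_schmidt_rank {k : Type*} [Field k] (d s : ℕ) (hd : 1 < d)
    (hchar : ringChar k = 0 ∨ d < ringChar k)
    (Q : MvPolynomial (Fin s) k) (hQ : Q.IsHomogeneous d)
    (Qt : MultilinearMap k (fun _ : Fin d => Fin s → k) k)
    (hsymm : ∀ (σ : Equiv.Perm (Fin d)) (x : Fin d → Fin s → k),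
      Qt (fun i => x (σ i)) = Qt x)
    (hrel : ∀ x : Fin s → k, Qt (fun _ => x) = (d.factorial : k) * MvPolynomial.eval x Q)
    (r : ℕ) (R S : Fin r → MvPolynomial (Fin s) k)
    (hRS : ∀ i, ∃ e, 0 < e ∧ e < d ∧ (R i).IsHomogeneous e ∧ (S i).IsHomogeneous (d - e))
    (hQdec : Q = ∑ i, R i * S i) :
    HasPrkDecomp Qt (d.choose (d / 2) * r) := by
  classical
  have hfac : (d.factorial : k) ≠ 0 := by
    intro h0
    have hdvd := (ringChar.spec k d.factorial).1 h0
    rcases hchar with h | h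
    · rw [h, zero_dvd_iff] at hdvd
      exact Nat.factorial_ne_zero d hdvd
    · have hp : (ringChar k).Prime :=
        (CharP.char_is_prime_or_zero k (ringChar k)).resolve_right (by omega)
      exact absurd ((hp.dvd_factorial).1 hdvd) (by omega)
  choose e he0 hed hR hS using hRS
  choose A hA using fun i => exists_multilinear (R i) (hR i)
  choose B hB using fun i => exists_multilinear (S i) (hS i)
  let ε : ∀ i, Fin (e i) ⊕ Fin (d - e i) ≃ Fin d := fun i =>
    finSumFinEquiv.trans (finCongr (by have := hed i; omega))
  let M : Fin r → MultilinearMap k (fun _ : Fin d => Fin s → k) k :=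
    fun i => mulForm (A i) (B i) (ε i)
  have hdiag : ∀ x, (Qt - (d.factorial : k) • ∑ i, M i) (fun _ => x) = 0 := by
    intro x
    rw [_root_.sub_apply, _root_.smul_apply, _root_.sum_apply, hrel,
      hQdec, map_sum, smul_eq_mul, sub_eq_zero]
    congr 1
    apply Finset.sum_congr rfl
    intro i _
    simp only [M]
    rw [mulForm_apply, hA, hB, map_mul]
  have hQt : Qt = ∑ i, ∑ σ : Equiv.Perm (Fin d), (M i).domDomCongr σ := by
    apply MultilinearMap.ext
    intro x
    have h := polar_zero _ hdiag x
    simp only [_root_.sub_apply, _root_.smul_apply, _root_.sum_apply,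
      Finset.sum_sub_distrib, hsymm, Finset.sum_const, Finset.card_univ, Fintype.card_perm,
      Fintype.card_fin, ← Finset.mul_sum, nsmul_eq_mul, smul_eq_mul] at h
    rw [← mul_sub] at h
    have h' := sub_eq_zero.1 ((mul_eq_zero.1 h).resolve_left hfac)
    rw [h', Finset.sum_comm]
    simp [_root_.sum_apply]
  rw [hQt]
  have := HasPrkDecomp.sum (Finset.univ : Finset (Fin r))
    (fun i => ∑ σ : Equiv.Perm (Fin d), (M i).domDomCongr σ) (d.choose (d / 2))
    (fun i _ => (symm_decomp (he0 i) (hed i) (A i) (B i) (ε i)).mono hd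
      (Nat.choose_le_middle _ _))
  rw [Finset.card_univ, Fintype.card_fin, mul_comm] at this
  exact this
end

section
/- Let k = Q (or more generally a field as in the main theorem) and let Q_1,...,Q_n be degree-d forms with d ≥ 2 over k, char condition satisfied. If the single-form multilinear bound prk_k(P) ≤ Ã[prk_{k̄}(P)+1]^{B̃} holds (perfect field version of the multilinear theorem), then the collection of forms satisfies rk_k(Q_1,...,Q_n) ≤ Ã · binom(d,⌊d/2⌋)^{B̃} · [n·rk_{k̄}(Q_1,...,Q_n) + 1]^{B̃}. -/
open scoped BigOperators

/-- The partition rank of a multilinear form. -/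
noncomputable def prk {k : Type*} [Field k] {d : ℕ} {V : Fin d → Type*}
    [∀ i, AddCommGroup (V i)] [∀ i, Module k (V i)]
    (P : MultilinearMap k V k) : ℕ :=
  sInf {r | HasPrkDecomp P r}

/-- Base change of a multilinear form on coordinate spaces over `k` to an extension
field `K`, via its coefficient tensor. -/
noncomputable def extendForm {k : Type*} [Field k] {d : ℕ} {s : Fin d → ℕ}
    (K : Type*) [Field K] [Algebra k K]
    (P : MultilinearMap k (fun i : Fin d => Fin (s i) → k) k) :
    MultilinearMap K (fun i : Fin d => Fin (s i) → K) K :=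
  ∑ kv : (∀ i : Fin d, Fin (s i)),
    (MultilinearMap.mkPiRing K (Fin d)
      (algebraMap k K (P (fun i => Pi.single (kv i) 1)))).compLinearMap
      (fun i => LinearMap.proj (kv i))

/-- `Q` is a sum of `r` products `R_i · S_i` of forms of positive degrees summing to `d`. -/
def HasSchmidtDecomp {k : Type*} [Field k] {σ : Type*} (d : ℕ)
    (Q : MvPolynomial σ k) (r : ℕ) : Prop :=
  ∃ R S : Fin r → MvPolynomial σ k,
    (∀ i, ∃ e, 0 < e ∧ e < d ∧ (R i).IsHomogeneous e ∧ (S i).IsHomogeneous (d - e)) ∧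
    Q = ∑ i, R i * S i

/-- The collective Schmidt rank of a family of degree-`d` forms: the minimum Schmidt rank
of a nontrivial linear combination. -/
noncomputable def cSchmidtRank {k : Type*} [Field k] {σ : Type*} (d : ℕ)
    {n : ℕ} (Q : Fin n → MvPolynomial σ k) : ℕ :=
  sInf {r | ∃ a : Fin n → k, a ≠ 0 ∧ HasSchmidtDecomp d (∑ i, a i • Q i) r}

open MvPolynomial

theorem pderiv_comm_aux {K σ : Type*} [Field K] (i j : σ) (p : MvPolynomial σ K) :
    pderiv i (pderiv j p) = pderiv j (pderiv i p) := by
  have h : ⁅(pderiv i : Derivation K (MvPolynomial σ K) (MvPolynomial σ K)),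
      (pderiv j : Derivation K (MvPolynomial σ K) (MvPolynomial σ K))⁆ = 0 := by
    classical
    apply MvPolynomial.derivation_ext
    intro l
    simp only [Derivation.commutator_apply, pderiv_X, Pi.single_apply]
    split_ifs <;> simp
  have h2 := congrArg (fun D => D p) h
  simpa [Derivation.commutator_apply, sub_eq_zero] using h2

instance pderivLC {K σ : Type*} [Field K] :
    LeftCommutative (fun (j : σ) (q : MvPolynomial σ K) => pderiv j q) :=
  ⟨fun i j p => pderiv_comm_aux i j p⟩

/-- iterated partial derivative along a multiset of variables -/
noncomputable def Dm {K σ : Type*} [Field K] (m : Multiset σ) (p : MvPolynomial σ K) :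
    MvPolynomial σ K :=
  m.foldr (fun (j : σ) (q : MvPolynomial σ K) => pderiv j q) p

theorem Dm_zero {K σ : Type*} [Field K] (p : MvPolynomial σ K) : Dm 0 p = p := by
  simp [Dm]

theorem Dm_cons {K σ : Type*} [Field K] (j : σ) (m : Multiset σ) (p : MvPolynomial σ K) :
    Dm (j ::ₘ m) p = pderiv j (Dm m p) := by
  simp [Dm]

theorem Dm_cons' {K σ : Type*} [Field K] (j : σ) (m : Multiset σ) (p : MvPolynomial σ K) :
    Dm (j ::ₘ m) p = Dm m (pderiv j p) := by
  induction m using Multiset.induction_on with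
  | empty => rw [Dm_cons, Dm_zero, Dm_zero]
  | cons a m ih => rw [Dm_cons, Dm_cons, pderiv_comm_aux, ← Dm_cons, ih, ← Dm_cons]

theorem Dm_sum {K σ α : Type*} [Field K] (m : Multiset σ) (s : Finset α)
    (p : α → MvPolynomial σ K) : Dm m (∑ i ∈ s, p i) = ∑ i ∈ s, Dm m (p i) := by
  induction m using Multiset.induction_on with
  | empty => simp [Dm_zero]
  | cons a m ih => simp [Dm_cons, ih, map_sum]

theorem Dm_map {K L σ : Type*} [Field K] [Field L] (φ : K →+* L) (m : Multiset σ)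
    (p : MvPolynomial σ K) : Dm m (map φ p) = map φ (Dm m p) := by
  induction m using Multiset.induction_on with
  | empty => simp [Dm_zero]
  | cons a m ih => simp [Dm_cons, ih, pderiv_map]

theorem Dm_homog {K σ : Type*} [Field K] (m : Multiset σ)
    (p : MvPolynomial σ K) {e : ℕ} (hp : p.IsHomogeneous e) :
    (Dm m p).IsHomogeneous (e - m.card) := by
  induction m using Multiset.induction_on with
  | empty => simpa [Dm_zero] using hp
  | cons a m ih =>
    rw [Dm_cons, Multiset.card_cons, ← Nat.sub_sub]
    exact ih.pderiv

theorem constantCoeff_homog {K σ : Type*} [Field K] (p : MvPolynomial σ K) {e : ℕ}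
    (hp : p.IsHomogeneous e) (he : e ≠ 0) : constantCoeff p = 0 := by
  by_contra h
  have := hp (d := 0) (by simpa [constantCoeff_eq] using h)
  simp at this
  exact he this.symm

theorem Dm_mul {K σ ι : Type*} [Field K] [DecidableEq ι] (kv : ι → σ) (A : Finset ι)
    (R S : MvPolynomial σ K) :
    Dm (A.val.map kv) (R * S) =
      ∑ B ∈ A.powerset, Dm (B.val.map kv) R * Dm ((A \ B).val.map kv) S := by
  induction A using Finset.induction_on with
  | empty => simp [Dm_zero]
  | insert a A ha ih =>
    rw [Finset.insert_val_of_notMem ha, Multiset.map_cons, Dm_cons, ih,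
      Finset.sum_powerset_insert ha, map_sum, ← Finset.sum_add_distrib]
    apply Finset.sum_congr rfl
    intro B hB
    have hBA := Finset.mem_powerset.1 hB
    have haB : a ∉ B := fun h => ha (hBA h)
    have h1 : insert a A \ B = insert a (A \ B) := Finset.insert_sdiff_of_notMem _ haB
    have h2 : insert a A \ insert a B = A \ B := by
      ext x; by_cases hx : x = a <;> simp [hx, ha]
    have h3 : a ∉ A \ B := fun h => ha (Finset.mem_sdiff.1 h).1
    rw [h1, h2, Finset.insert_val_of_notMem haB, Finset.insert_val_of_notMem h3,
      Multiset.map_cons, Multiset.map_cons, Dm_cons, Dm_cons, pderiv_mul, add_comm]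

theorem Dm_mul_const {K σ : Type*} [Field K] {d : ℕ} (kv : Fin d → σ) {e : ℕ} (he : e ≤ d)
    (R S : MvPolynomial σ K) (hR : R.IsHomogeneous e) (hS : S.IsHomogeneous (d - e)) :
    constantCoeff (Dm ((Finset.univ : Finset (Fin d)).val.map kv) (R * S)) =
      ∑ B ∈ (Finset.univ : Finset (Fin d)).powersetCard e,
        constantCoeff (Dm (B.val.map kv) R) * constantCoeff (Dm (Bᶜ.val.map kv) S) := by
  rw [Dm_mul, map_sum]
  symm
  simp only [map_mul]
  apply Finset.sum_subset
  · intro B hB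
    simp
  · intro B _ hB
    have hc : B.card ≠ e := by simpa [Finset.mem_powersetCard] using hB
    rcases lt_or_gt_of_ne hc with h | h
    · rw [constantCoeff_homog _ (Dm_homog _ _ hR), zero_mul]
      simp; omega
    · rw [constantCoeff_homog _ (Dm_homog (Bᶜ.val.map kv) _ hS), mul_zero]
      have := Finset.card_compl B
      have h4 : B.card ≤ d := by simpa using Finset.card_le_univ B
      simp [Finset.card_compl]; omega

theorem euler_full {K : Type*} [Field K] {s : ℕ} (d : ℕ) (Q : MvPolynomial (Fin s) K)
    (hQ : Q.IsHomogeneous d) :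
    ∑ kv : Fin d → Fin s, C (constantCoeff (Dm ((Finset.univ : Finset (Fin d)).val.map kv) Q)) *
      ∏ i, X (kv i) = (d.factorial : MvPolynomial (Fin s) K) * Q := by
  induction d generalizing Q with
  | zero =>
    have := (totalDegree_eq_zero_iff_eq_C (p := Q)).1 (by simpa using hQ.totalDegree_le)
    simp [Dm_zero]
    rw [this]; simp
  | succ d ih =>
    rw [← (Fin.consEquiv (fun _ => Fin s)).sum_comp, Fintype.sum_prod_type]
    have key : ∀ j : Fin s, ∑ kv : Fin d → Fin s,
        C (constantCoeff (Dm ((Finset.univ : Finset (Fin (d+1))).val.map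
          (Fin.consEquiv (fun _ => Fin s) (j, kv))) Q)) *
          ∏ i, X ((Fin.consEquiv (fun _ => Fin s) (j, kv)) i) =
        (d.factorial : MvPolynomial (Fin s) K) * (X j * pderiv j Q) := by
      intro j
      have := ih (pderiv j Q) (by simpa using hQ.pderiv)
      rw [mul_left_comm, ← this, Finset.mul_sum]
      apply Finset.sum_congr rfl
      intro kv _
      have hm : (Finset.univ : Finset (Fin (d+1))).val.map
          (Fin.consEquiv (fun _ => Fin s) (j, kv)) = j ::ₘ Finset.univ.val.map kv := by
        rw [Fin.univ_succ]
        simp [Fin.consEquiv]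
      rw [hm, Dm_cons', Fin.prod_univ_succ]
      simp [Fin.consEquiv]
      ring
    rw [Finset.sum_congr rfl (fun j _ => key j), ← Finset.mul_sum, hQ.sum_X_mul_pderiv,
      Nat.factorial_succ]
    push_cast
    rw [nsmul_eq_mul]; push_cast; ring
/-- multilinear form with given coefficient tensor -/
noncomputable def tForm {K ι : Type*} [Field K] [Fintype ι] [DecidableEq ι] {s : ℕ} (c : (ι → Fin s) → K) :
    MultilinearMap K (fun _ : ι => Fin s → K) K :=
  ∑ kv : ι → Fin s, (MultilinearMap.mkPiRing K ι (c kv)).compLinearMap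
      (fun i => LinearMap.proj (kv i))

theorem tForm_apply {K ι : Type*} [Field K] [Fintype ι] [DecidableEq ι] {s : ℕ} (c : (ι → Fin s) → K)
    (x : ι → Fin s → K) : tForm c x = ∑ kv : ι → Fin s, (∏ i, x i (kv i)) * c kv := by
  simp [tForm, _root_.sum_apply]

theorem sum_split {M ι κ : Type*} [CommSemiring M] [Fintype ι] [Fintype κ] [DecidableEq ι] (I : Set ι)
    [Fintype I] [Fintype ↥Iᶜ] (F : (I → κ) → M) (G : (↥Iᶜ → κ) → M) :
    ∑ kv : ι → κ, F (fun i => kv i.1) * G (fun j => kv j.1) = (∑ u, F u) * ∑ v, G v := by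
  classical
  rw [Finset.sum_mul_sum, ← Fintype.sum_prod_type']
  let E : (ι → κ) ≃ (I → κ) × (↥Iᶜ → κ) :=
    { toFun := fun kv => (fun i => kv i.1, fun j => kv j.1)
      invFun := fun p i => if h : i ∈ I then p.1 ⟨i, h⟩ else p.2 ⟨i, h⟩
      left_inv := fun kv => by ext i; simp
      right_inv := fun p => by
        ext i
        · simp
        · have := i.2
          simp only [Set.mem_compl_iff] at this
          simp [this] }
  exact Fintype.sum_equiv E _ (fun p => F p.1 * G p.2) (fun _ => rfl)

theorem prod_split {M ι : Type*} [CommMonoid M] [Fintype ι] (I : Set ι)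
    [Fintype I] [Fintype ↥Iᶜ] (f : ι → M) :
    ∏ i, f i = (∏ i : I, f i.1) * ∏ j : ↥Iᶜ, f j.1 := by
  classical
  rw [← Finset.prod_mul_prod_compl I.toFinset f]
  congr 1
  · exact Finset.prod_subtype _ (by simp) f
  · exact Finset.prod_subtype (p := (· ∈ Iᶜ)) _ (by simp) f

theorem val_map_split {ι σ : Type*} (I : Set ι) [Fintype I] (A : Finset ι)
    (h : ∀ i, i ∈ A ↔ i ∈ I) (kv : ι → σ) :
    (Finset.univ : Finset I).val.map (fun i => kv i.1) = A.val.map kv := by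
  have : A = Finset.univ.map (Function.Embedding.subtype (· ∈ I)) := by
    ext i; simp [h]
  rw [this, Finset.map_val, Multiset.map_map]
  rfl

theorem tForm_rankOne {K : Type*} [Field K] {d s : ℕ} (c : (Fin d → Fin s) → K)
    (I : Set (Fin d)) (h1 : I.Nonempty) (h2 : Iᶜ.Nonempty)
    (f : (I → Fin s) → K) (g : (↥Iᶜ → Fin s) → K)
    (hc : ∀ kv, c kv = f (fun i => kv i.1) * g (fun j => kv j.1)) :
    IsPartRankOne (tForm c) := by
  classical
  refine ⟨I, h1, h2, tForm f, tForm g, fun x => ?_⟩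
  rw [tForm_apply, tForm_apply, tForm_apply, ← sum_split]
  apply Finset.sum_congr rfl
  intro kv _
  rw [prod_split I, hc]
  ring

theorem prk_one {k : Type*} [Field k] {d : ℕ} {V : Fin d → Type*}
    [∀ i, AddCommGroup (V i)] [∀ i, Module k (V i)]
    {P : MultilinearMap k V k} (h : IsPartRankOne P) : HasPrkDecomp P 1 :=
  ⟨fun _ => P, fun _ => h, by simp⟩

theorem prk_add {k : Type*} [Field k] {d : ℕ} {V : Fin d → Type*}
    [∀ i, AddCommGroup (V i)] [∀ i, Module k (V i)]
    {P P' : MultilinearMap k V k} {r r' : ℕ} (h : HasPrkDecomp P r) (h' : HasPrkDecomp P' r') :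
    HasPrkDecomp (P + P') (r + r') := by
  obtain ⟨Q, hQ, rfl⟩ := h
  obtain ⟨Q', hQ', rfl⟩ := h'
  refine ⟨Fin.append Q Q', fun i => ?_, ?_⟩
  · refine Fin.addCases (fun i => ?_) (fun i => ?_) i
    · simpa using hQ i
    · simpa using hQ' i
  · simp [Fin.sum_univ_add]

theorem prk_sum {k : Type*} [Field k] {d : ℕ} {V : Fin d → Type*}
    [∀ i, AddCommGroup (V i)] [∀ i, Module k (V i)] {α : Type*} (A : Finset α)
    (P : α → MultilinearMap k V k) (r : ℕ) (h : ∀ i ∈ A, HasPrkDecomp (P i) r) :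
    HasPrkDecomp (∑ i ∈ A, P i) (A.card * r) := by
  classical
  induction A using Finset.induction_on with
  | empty => exact ⟨fun _ => 0, fun i => absurd i.2 (by simp), by simp⟩
  | insert a A ha ih =>
    rw [Finset.sum_insert ha, Finset.card_insert_of_notMem ha, add_mul, one_mul, add_comm _ r]
    exact prk_add (h a (by simp)) (ih (fun i hi => h i (by simp [hi])))

theorem prk_zero {k : Type*} [Field k] {d : ℕ} (hd : 2 ≤ d) {V : Fin d → Type*}
    [∀ i, AddCommGroup (V i)] [∀ i, Module k (V i)] (r : ℕ) :
    HasPrkDecomp (0 : MultilinearMap k V k) r := by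
  refine ⟨fun _ => 0, fun _ => ?_, by simp⟩
  refine ⟨{(⟨0, by omega⟩ : Fin d)}, by simp, ⟨(⟨1, by omega⟩ : Fin d), by simp [Fin.ext_iff]⟩, 0, 0, by simp⟩

theorem prk_mono {k : Type*} [Field k] {d : ℕ} (hd : 2 ≤ d) {V : Fin d → Type*}
    [∀ i, AddCommGroup (V i)] [∀ i, Module k (V i)]
    {P : MultilinearMap k V k} {r r' : ℕ} (h : HasPrkDecomp P r) (hr : r ≤ r') :
    HasPrkDecomp P r' := by
  obtain ⟨t, rfl⟩ := Nat.exists_eq_add_of_le hr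
  simpa using prk_add h (prk_zero hd t)

theorem tForm_sum {K ι α : Type*} [Field K] [Fintype ι] [DecidableEq ι] {s : ℕ} (A : Finset α)
    (c : α → (ι → Fin s) → K) : tForm (fun kv => ∑ a ∈ A, c a kv) = ∑ a ∈ A, tForm (c a) := by
  apply MultilinearMap.ext
  intro x
  rw [_root_.sum_apply]
  simp only [tForm_apply, Finset.mul_sum]
  rw [Finset.sum_comm]

theorem tForm_single {K ι : Type*} [Field K] [Fintype ι] [DecidableEq ι] {s : ℕ} (c : (ι → Fin s) → K)
    (kv : ι → Fin s) : tForm c (fun i => Pi.single (kv i) 1) = c kv := by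
  classical
  rw [tForm_apply, Finset.sum_eq_single kv]
  · simp
  · intro b _ hb
    obtain ⟨i, hi⟩ := Function.ne_iff.1 hb
    rw [Finset.prod_eq_zero (Finset.mem_univ i), zero_mul]
    simp [hi]
  · simp

theorem multilinear_eq_tForm {K ι : Type*} [Field K] [Fintype ι] [DecidableEq ι] {s : ℕ}
    (P : MultilinearMap K (fun _ : ι => Fin s → K) K) :
    P = tForm (fun kv => P (fun i => Pi.single (kv i) 1)) := by
  classical
  apply Module.Basis.ext_multilinear (fun _ => Pi.basisFun K (Fin s))
  intro kv
  simp only [Pi.basisFun_apply]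
  rw [tForm_single]

theorem prk_exists {K : Type*} [Field K] {d s : ℕ} (hd : 2 ≤ d)
    (P : MultilinearMap K (fun _ : Fin d => Fin s → K) K) : ∃ r, HasPrkDecomp P r := by
  classical
  have : P = ∑ u : Fin d → Fin s,
      tForm (fun kv => if kv = u then P (fun i => Pi.single (u i) 1) else 0) := by
    rw [← tForm_sum]
    conv_lhs => rw [multilinear_eq_tForm P]
    congr 1
    ext kv
    simp
  rw [this]
  refine ⟨_, prk_sum _ _ 1 (fun u _ => prk_one ?_)⟩
  refine tForm_rankOne _ {(⟨0, by omega⟩ : Fin d)} (by simp)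
    ⟨(⟨1, by omega⟩ : Fin d), by simp [Fin.ext_iff]⟩
    (fun v => if v = (fun i => u i.1) then P (fun i => Pi.single (u i) 1) else 0)
    (fun v => if v = (fun i => u i.1) then 1 else 0) ?_
  intro kv
  by_cases h : kv = u
  · simp [h]
  · obtain ⟨i, hi⟩ := Function.ne_iff.1 h
    rw [if_neg h]
    by_cases hi0 : i = ⟨0, by omega⟩
    · rw [if_neg, zero_mul]
      intro hh
      exact hi (congrFun hh ⟨i, by simp [hi0]⟩)
    · rw [if_neg (c := _ = fun j : ↥(({⟨0, by omega⟩} : Set (Fin d))ᶜ) => u j.1), mul_zero]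
      intro hh
      exact hi (congrFun hh ⟨i, by simp [hi0]⟩)

/-- the polarization of a polynomial -/
noncomputable def pol {K : Type*} [Field K] {s : ℕ} (d : ℕ) (Q : MvPolynomial (Fin s) K) :
    MultilinearMap K (fun _ : Fin d => Fin s → K) K :=
  tForm (fun kv => constantCoeff (Dm ((Finset.univ : Finset (Fin d)).val.map kv) Q))

theorem pol_extend {K L : Type*} [Field K] [Field L] [Algebra K L] {s d : ℕ}
    (Q : MvPolynomial (Fin s) K) :
    extendForm L (pol d Q) = pol d (map (algebraMap K L) Q) := by
  apply MultilinearMap.ext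
  intro x
  rw [pol, pol, tForm_apply, extendForm, _root_.sum_apply]
  apply Finset.sum_congr rfl
  intro kv _
  rw [tForm_single, Dm_map]
  simp [constantCoeff_map]

theorem pol_prk {K : Type*} [Field K] {s d : ℕ} (hd : 2 ≤ d) (Q : MvPolynomial (Fin s) K) (r : ℕ)
    (h : HasSchmidtDecomp d Q r) : HasPrkDecomp (pol d Q) (r * d.choose (d / 2)) := by
  classical
  obtain ⟨R, S, hRS, rfl⟩ := h
  have : pol d (∑ i, R i * S i) = ∑ i, pol d (R i * S i) := by
    simp only [pol]
    rw [← tForm_sum]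
    simp [Dm_sum]
  rw [this]
  have := prk_sum (Finset.univ : Finset (Fin r)) (fun i => pol d (R i * S i)) (d.choose (d / 2)) ?_
  · simpa using this
  intro i _
  obtain ⟨e, he0, hed, hR, hS⟩ := hRS i
  refine prk_mono hd ?_ (Nat.choose_le_middle e d)
  have h1 : pol d (R i * S i) = ∑ B ∈ (Finset.univ : Finset (Fin d)).powersetCard e,
      tForm (fun kv => constantCoeff (Dm (B.val.map kv) (R i)) *
        constantCoeff (Dm (Bᶜ.val.map kv) (S i))) := by
    rw [← tForm_sum, pol]
    congr 1
    ext kv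
    exact Dm_mul_const kv hed.le _ _ hR hS
  rw [h1]
  have h2 := prk_sum ((Finset.univ : Finset (Fin d)).powersetCard e)
    (fun B => tForm (fun kv : Fin d → Fin s => constantCoeff (Dm (B.val.map kv) (R i)) *
        constantCoeff (Dm (Bᶜ.val.map kv) (S i)))) 1 ?_
  · simpa using h2
  intro B hB
  have hB := (Finset.mem_powersetCard.1 hB).2
  apply prk_one
  refine tForm_rankOne _ (B : Set (Fin d)) ?_ ?_
    (fun u => constantCoeff (Dm (Finset.univ.val.map u) (R i)))
    (fun u => constantCoeff (Dm (Finset.univ.val.map u) (S i))) ?_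
  · rw [Finset.coe_nonempty, ← Finset.card_pos]; omega
  · rw [← Finset.coe_compl, Finset.coe_nonempty, ← Finset.card_pos, Finset.card_compl]
    simp; omega
  · intro kv
    rw [val_map_split _ B (by simp), val_map_split _ Bᶜ (by simp)]

/-- the diagonal polynomial of a multilinear form -/
noncomputable def diag {K ι : Type*} [Field K] [Fintype ι] [DecidableEq ι] {s : ℕ}
    (P : MultilinearMap K (fun _ : ι => Fin s → K) K) : MvPolynomial (Fin s) K :=
  ∑ kv : ι → Fin s, C (P (fun i => Pi.single (kv i) 1)) * ∏ i, X (kv i)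

theorem diag_homog {K ι : Type*} [Field K] [Fintype ι] [DecidableEq ι] {s : ℕ}
    (P : MultilinearMap K (fun _ : ι => Fin s → K) K) :
    (diag P).IsHomogeneous (Fintype.card ι) := by
  classical
  apply IsHomogeneous.sum
  intro kv _
  have h : (∏ i : ι, (X (kv i) : MvPolynomial (Fin s) K)).IsHomogeneous (∑ _i : ι, 1) :=
    IsHomogeneous.prod _ _ _ (fun i _ => isHomogeneous_X _ _)
  simpa using (isHomogeneous_C (Fin s) (P (fun i => Pi.single (kv i) 1))).mul h

theorem diag_sum {K ι α : Type*} [Field K] [Fintype ι] [DecidableEq ι] {s : ℕ} (A : Finset α)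
    (P : α → MultilinearMap K (fun _ : ι => Fin s → K) K) :
    diag (∑ a ∈ A, P a) = ∑ a ∈ A, diag (P a) := by
  simp only [diag, _root_.sum_apply, map_sum, Finset.sum_mul]
  rw [Finset.sum_comm]

theorem schmidt_of_prk {K : Type*} [Field K] {s d : ℕ}
    (P : MultilinearMap K (fun _ : Fin d => Fin s → K) K) (r : ℕ) (h : HasPrkDecomp P r) :
    HasSchmidtDecomp d (diag P) r := by
  classical
  obtain ⟨Q, hQ, rfl⟩ := h
  choose I h1 h2 R S hRS using hQ
  refine ⟨fun i => diag (R i), fun i => diag (S i), fun i => ?_, ?_⟩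
  · have hc : Fintype.card (I i) + Fintype.card ↥(I i)ᶜ = d := by
      rw [Fintype.card_compl_set]
      have := set_fintype_card_le_univ (I i)
      simp at this ⊢
      omega
    have := (h1 i).to_subtype
    have := (h2 i).to_subtype
    have h3 : 0 < Fintype.card (I i) := Fintype.card_pos
    have h4 : 0 < Fintype.card ↥(I i)ᶜ := Fintype.card_pos
    refine ⟨Fintype.card (I i), h3, by omega, diag_homog _, ?_⟩
    rw [show d - Fintype.card (I i) = Fintype.card ↥(I i)ᶜ by omega]
    exact diag_homog _
  · rw [diag_sum]
    apply Finset.sum_congr rfl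
    intro i _
    simp only [diag]
    rw [← sum_split]
    apply Fintype.sum_congr
    intro kv
    rw [hRS, prod_split (I i), C_mul]
    ring

theorem diag_pol {K : Type*} [Field K] {s d : ℕ} (Q : MvPolynomial (Fin s) K)
    (hQ : Q.IsHomogeneous d) :
    diag (pol d Q) = (d.factorial : MvPolynomial (Fin s) K) * Q := by
  classical
  rw [← euler_full d Q hQ]
  simp only [diag, pol, tForm_single]
theorem schmidt_add {k σ : Type*} [Field k] {d : ℕ}
    {P P' : MvPolynomial σ k} {r r' : ℕ} (h : HasSchmidtDecomp d P r)
    (h' : HasSchmidtDecomp d P' r') : HasSchmidtDecomp d (P + P') (r + r') := by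
  obtain ⟨R, S, hQ, rfl⟩ := h
  obtain ⟨R', S', hQ', rfl⟩ := h'
  refine ⟨Fin.append R R', Fin.append S S', fun i => ?_, ?_⟩
  · refine Fin.addCases (fun i => ?_) (fun i => ?_) i
    · simpa using hQ i
    · simpa using hQ' i
  · simp [Fin.sum_univ_add]

theorem schmidt_smul {k σ : Type*} [Field k] {d : ℕ}
    {P : MvPolynomial σ k} {r : ℕ} (c : k) (h : HasSchmidtDecomp d P r) :
    HasSchmidtDecomp d (c • P) r := by
  obtain ⟨R, S, hQ, rfl⟩ := h
  refine ⟨fun i => c • R i, S, fun i => ?_, ?_⟩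
  · obtain ⟨e, h0, h1, h2, h3⟩ := hQ i
    refine ⟨e, h0, h1, ?_, h3⟩
    change (c • R i).IsHomogeneous e
    rw [smul_eq_C_mul]
    simpa using (isHomogeneous_C σ c).mul h2
  · simp [Finset.smul_sum]

theorem schmidt_map {k K σ : Type*} [Field k] [Field K] {d : ℕ} (φ : k →+* K)
    {P : MvPolynomial σ k} {r : ℕ} (h : HasSchmidtDecomp d P r) :
    HasSchmidtDecomp d (map φ P) r := by
  obtain ⟨R, S, hQ, rfl⟩ := h
  refine ⟨fun i => map φ (R i), fun i => map φ (S i), fun i => ?_, ?_⟩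
  · obtain ⟨e, h0, h1, h2, h3⟩ := hQ i
    exact ⟨e, h0, h1, h2.map φ, h3.map φ⟩
  · simp

theorem schmidt_sum {k σ α : Type*} [Field k] {d : ℕ} (A : Finset α)
    (P : α → MvPolynomial σ k) (r : ℕ) (h : ∀ i ∈ A, HasSchmidtDecomp d (P i) r) :
    HasSchmidtDecomp d (∑ i ∈ A, P i) (A.card * r) := by
  classical
  induction A using Finset.induction_on with
  | empty => exact ⟨fun _ => 0, fun _ => 0, fun i => absurd i.2 (by simp), by simp⟩
  | insert a A ha ih =>
    rw [Finset.sum_insert ha, Finset.card_insert_of_notMem ha, add_mul, one_mul, add_comm _ r]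
    exact schmidt_add (h a (by simp)) (ih (fun i hi => h i (by simp [hi])))

theorem schmidt_mono {k σ : Type*} [Field k] {d : ℕ} (hd : 2 ≤ d)
    {P : MvPolynomial σ k} {r r' : ℕ} (h : HasSchmidtDecomp d P r) (hr : r ≤ r') :
    HasSchmidtDecomp d P r' := by
  obtain ⟨t, rfl⟩ := Nat.exists_eq_add_of_le hr
  have h0 : HasSchmidtDecomp d (0 : MvPolynomial σ k) t :=
    ⟨fun _ => 0, fun _ => 0, fun i => ⟨1, by omega, by omega, isHomogeneous_zero _ _ _,
      isHomogeneous_zero _ _ _⟩, by simp⟩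
  simpa using schmidt_add h h0

/-- Galois descent: the span of the conjugates of a nonzero vector contains a nonzero
rational vector. -/
theorem galois_descent {k K : Type*} [Field k] [Field K] [Algebra k K] [IsGalois k K] {n : ℕ}
    (a : Fin n → K) (ha : a ≠ 0) :
    ∃ b : Fin n → k, b ≠ 0 ∧ (fun i => algebraMap k K (b i)) ∈
      Submodule.span K (Set.range (fun (g : K ≃ₐ[k] K) => fun i => g (a i))) := by
  classical
  set W := Submodule.span K (Set.range (fun (g : K ≃ₐ[k] K) => fun i => g (a i))) with hW
  have hstab : ∀ (g : K ≃ₐ[k] K) (w : Fin n → K), w ∈ W → (fun i => g (w i)) ∈ W := by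
    intro g w hw
    induction hw using Submodule.span_induction with
    | mem x hx =>
      obtain ⟨h, rfl⟩ := hx
      exact Submodule.subset_span ⟨g * h, rfl⟩
    | zero =>
      convert W.zero_mem using 1
      ext i; simp
    | add x y _ _ hx hy =>
      convert W.add_mem hx hy using 1
      ext i; simp
    | smul c x _ hx =>
      convert W.smul_mem (g c) hx using 1
      ext i; simp
  have hex : ∃ m, ∃ w ∈ W, w ≠ 0 ∧ (Finset.univ.filter (fun i => w i ≠ 0)).card = m :=
    ⟨_, a, Submodule.subset_span ⟨1, rfl⟩, ha, rfl⟩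
  obtain ⟨w, hwW, hw0, hcard⟩ := Nat.find_spec hex
  obtain ⟨i0, hi0⟩ := Function.ne_iff.1 hw0
  have hi0 : w i0 ≠ 0 := hi0
  set v : Fin n → K := (w i0)⁻¹ • w with hv
  have hvW : v ∈ W := W.smul_mem _ hwW
  have hv1 : v i0 = 1 := by simp [hv, hi0]
  have hfix : ∀ (g : K ≃ₐ[k] K) i, g (v i) = v i := by
    intro g
    by_contra hne
    have hu0 : (fun i => g (v i)) - v ≠ 0 := by
      intro h
      exact hne (fun i => sub_eq_zero.1 (congrFun h i))
    refine Nat.find_min hex (m := (Finset.univ.filter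
      (fun i => ((fun i => g (v i)) - v) i ≠ 0)).card) ?_
      ⟨_, W.sub_mem (hstab g v hvW) hvW, hu0, rfl⟩
    rw [← hcard]
    apply Finset.card_lt_card
    rw [Finset.ssubset_iff_of_subset]
    · exact ⟨i0, by simp [hi0], by simp [hv1]⟩
    · intro i
      simp only [Finset.mem_filter, Finset.mem_univ, true_and]
      intro h1 h2
      apply h1
      simp [hv, h2]
  have hr : ∀ i, ∃ b : k, algebraMap k K b = v i := fun i =>
    (InfiniteGalois.mem_range_algebraMap_iff_fixed (v i)).2 (fun g => hfix g i)
  choose b hb using hr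
  refine ⟨b, ?_, ?_⟩
  · intro h
    have := hb i0
    simp [h, hv1] at this
  · simpa [hb] using hvW

theorem schmidt_descent {k K : Type*} [Field k] [Field K] [Algebra k K] [IsGalois k K]
    {σ : Type*} {n d : ℕ} (hd : 2 ≤ d) (Q : Fin n → MvPolynomial σ k) (a : Fin n → K) (ha : a ≠ 0)
    (r : ℕ) (h : HasSchmidtDecomp d (∑ i, a i • map (algebraMap k K) (Q i)) r) :
    ∃ b : Fin n → k, b ≠ 0 ∧
      HasSchmidtDecomp d (map (algebraMap k K) (∑ i, b i • Q i)) (n * r) := by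
  classical
  obtain ⟨b, hb0, hb⟩ := galois_descent (k := k) a ha
  refine ⟨b, hb0, ?_⟩
  obtain ⟨T, hT, hspan, hli⟩ := exists_linearIndependent K
    (Set.range (fun (g : K ≃ₐ[k] K) => fun i => g (a i)))
  rw [← hspan] at hb
  have hfin : T.Finite := hli.setFinite
  have hTc : hfin.toFinset.card ≤ n := by
    have := hfin.fintype
    have h2 := hli.fintype_card_le_finrank
    rw [Module.finrank_fin_fun] at h2
    rwa [Set.Finite.card_toFinset]
  rw [← hfin.coe_toFinset, Submodule.mem_span_finset] at hb
  obtain ⟨f, -, hf⟩ := hb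
  have hconj : ∀ t ∈ T, HasSchmidtDecomp d (∑ i, t i • map (algebraMap k K) (Q i)) r := by
    intro t ht
    obtain ⟨g, rfl⟩ := hT ht
    have := schmidt_map (g : K →+* K) h
    convert this using 1
    rw [map_sum]
    apply Finset.sum_congr rfl
    intro i _
    rw [smul_eq_C_mul, smul_eq_C_mul, map_mul, map_C, map_map]
    congr 2
    congr 1
    ext x
    simp
  have hfi : ∀ i, algebraMap k K (b i) = ∑ t ∈ hfin.toFinset, f t * t i := by
    intro i
    have := congrFun hf i
    simpa using this.symm
  have heq : map (algebraMap k K) (∑ i, b i • Q i) =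
      ∑ t ∈ hfin.toFinset, f t • ∑ i, t i • map (algebraMap k K) (Q i) := by
    simp only [Finset.smul_sum, smul_smul]
    rw [Finset.sum_comm, map_sum]
    apply Finset.sum_congr rfl
    intro i _
    rw [← Finset.sum_smul, ← hfi, smul_eq_C_mul, smul_eq_C_mul, map_mul, map_C]
  rw [heq]
  refine schmidt_mono hd (schmidt_sum _ _ r fun t ht => schmidt_smul _ (hconj t ?_))
    (Nat.mul_le_mul_right r hTc)
  simpa using ht

theorem factorial_ne_zero_of_char {k : Type*} [Field k] (d : ℕ)
    (hchar : ringChar k = 0 ∨ d < ringChar k) : (d.factorial : k) ≠ 0 := by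
  rw [Ne, ringChar.spec]
  rcases hchar with h | h
  · rw [h, zero_dvd_iff]; exact d.factorial_ne_zero
  · have hp : (ringChar k).Prime :=
      (CharP.char_is_prime_or_zero k (ringChar k)).resolve_right (by omega)
    rw [hp.dvd_factorial]; omega

/-- over a perfect field `k` with `char k = 0` or `char k > d ≥ 2`, if the
single-form multilinear bound `prk_k(P) ≤ Ã (prk_{k̄}(P) + 1)^{B̃}` holds, then degree-`d`
forms `Q_1,...,Q_n` satisfy
`rk_k(Q_1,...,Q_n) ≤ Ã · binom(d,⌊d/2⌋)^{B̃} · (n · rk_{k̄}(Q_1,...,Q_n) + 1)^{B̃}`. -/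
theorem main_deduction_for_forms {k : Type*} [Field k] [PerfectField k]
    (d s n : ℕ) (hd : 2 ≤ d) (hn : 0 < n)
    (hchar : ringChar k = 0 ∨ d < ringChar k)
    (At Bt : ℕ)
    (hsingle : ∀ P : MultilinearMap k (fun _ : Fin d => Fin s → k) k,
      prk P ≤ At * (prk (extendForm (AlgebraicClosure k) P) + 1) ^ Bt)
    (Q : Fin n → MvPolynomial (Fin s) k) (hQ : ∀ i, (Q i).IsHomogeneous d) :
    cSchmidtRank d Q ≤ At * (d.choose (d / 2)) ^ Bt *
      (n * cSchmidtRank d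
        (fun i => (Q i).map (algebraMap k (AlgebraicClosure k))) + 1) ^ Bt := by
  set K := AlgebraicClosure k
  have hgal : IsGalois k K := inferInstance
  rcases Set.eq_empty_or_nonempty {r | ∃ a : Fin n → k, a ≠ 0 ∧
      HasSchmidtDecomp d (∑ i, a i • Q i) r} with hemp | ⟨r0, a0, ha0, h0⟩
  · rw [cSchmidtRank, hemp]; simp
  have hne : {r | ∃ a : Fin n → K, a ≠ 0 ∧
      HasSchmidtDecomp d (∑ i, a i • (Q i).map (algebraMap k K)) r}.Nonempty := by
    refine ⟨r0, fun i => algebraMap k K (a0 i), ?_, ?_⟩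
    · intro h
      apply ha0
      ext i
      have := congrFun h i
      simpa using this
    · have := schmidt_map (algebraMap k K) h0
      simpa only [map_sum, smul_eq_C_mul, map_mul, map_C] using this
  obtain ⟨a, ha, hdec⟩ := Nat.sInf_mem hne
  set r := cSchmidtRank d (fun i => (Q i).map (algebraMap k K)) with hr
  change HasSchmidtDecomp d _ r at hdec
  obtain ⟨b, hb0, hb⟩ := schmidt_descent hd Q a ha r hdec
  set F := ∑ i, b i • Q i with hF
  have hFh : F.IsHomogeneous d := by
    apply IsHomogeneous.sum
    intro i _
    rw [smul_eq_C_mul]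
    simpa using (isHomogeneous_C (Fin s) (b i)).mul (hQ i)
  have h1 : prk (extendForm K (pol d F)) ≤ n * r * d.choose (d / 2) := by
    apply Nat.sInf_le
    have := pol_prk hd _ _ hb
    rw [← pol_extend] at this
    exact this
  have h2 : HasPrkDecomp (pol d F) (prk (pol d F)) := Nat.sInf_mem (prk_exists hd (pol d F))
  have h3 := schmidt_smul ((d.factorial : k)⁻¹) (schmidt_of_prk _ _ h2)
  have h4 : ((d.factorial : k)⁻¹) • diag (pol d F) = F := by
    rw [diag_pol F hFh, smul_eq_C_mul, ← mul_assoc,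
      show ((d.factorial : ℕ) : MvPolynomial (Fin s) k) = C (d.factorial : k) by simp,
      ← C_mul, inv_mul_cancel₀ (factorial_ne_zero_of_char d hchar)]
    simp
  rw [h4] at h3
  have h5 : cSchmidtRank d Q ≤ prk (pol d F) := Nat.sInf_le ⟨b, hb0, h3⟩
  have hC : 1 ≤ d.choose (d / 2) := Nat.choose_pos (Nat.div_le_self d 2)
  calc cSchmidtRank d Q ≤ prk (pol d F) := h5
    _ ≤ At * (prk (extendForm K (pol d F)) + 1) ^ Bt := hsingle _
    _ ≤ At * (d.choose (d / 2) * (n * r + 1)) ^ Bt := by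
      gcongr
      nlinarith
    _ = _ := by rw [mul_pow, mul_assoc]
end
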